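/- Fix an integer m ≥ 2, let θ = π/(m+1) and ρ_1 = 1/(4·cos²θ). Then for every integer r with 0 ≤ r < m, the evaluation p_r(ρ_1) is strictly positive. -/

import Mathlib

/-- The Chebyshev-type polynomial sequence over `ℝ`: `p 0 = p 1 = 1`,
`p (r+2) = p (r+1) - X * p r`. -/
noncomputable def chebR : ℕ → Polynomial ℝ
  | 0 => 1
  | 1 => 1
  | (r+2) => chebR (r+1) - Polynomial.X * chebR r

theorem chebR_aux (t : ℝ) (hc : Real.cos t ≠ 0) (r : ℕ) :
    (chebR r).eval (1 / (4 * Real.cos t ^ 2)) * (2 * Real.cos t) ^ r * Real.sin t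
        = Real.sin (((r : ℝ) + 1) * t) ∧
    (chebR (r+1)).eval (1 / (4 * Real.cos t ^ 2)) * (2 * Real.cos t) ^ (r+1) * Real.sin t
        = Real.sin (((r : ℝ) + 2) * t) := by
  induction r with
  | zero =>
    constructor
    · simp [chebR]
    · simp [chebR, Real.sin_two_mul]; ring
  | succ k ih =>
    obtain ⟨h1, h2⟩ := ih
    have e1 : ((k + 1 : ℕ) : ℝ) + 1 = (k : ℝ) + 2 := by push_cast; ring
    refine ⟨by rw [e1]; exact h2, ?_⟩
    have e3 : Real.sin ((((k + 1 : ℕ) : ℝ) + 2) * t)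
        = 2 * Real.cos t * Real.sin (((k : ℝ) + 2) * t) - Real.sin (((k : ℝ) + 1) * t) := by
      have a : (((k + 1 : ℕ) : ℝ) + 2) * t = ((k : ℝ) + 2) * t + t := by push_cast; ring
      have b : ((k : ℝ) + 1) * t = ((k : ℝ) + 2) * t - t := by ring
      rw [a, b, Real.sin_add, Real.sin_sub]; ring
    rw [e3, ← h1, ← h2]
    simp only [chebR, Polynomial.eval_sub, Polynomial.eval_mul, Polynomial.eval_X]
    field_simp
    ring

/-- fix `m ≥ 2`, let `θ = π/(m+1)` and `ρ₁ = 1/(4cos²θ)`.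
Then for every `0 ≤ r < m`, the evaluation `p_r(ρ₁)` is strictly positive. -/
theorem statement10 (m : ℕ) (hm : 2 ≤ m) (r : ℕ) (hr : r < m) :
    0 < (chebR r).eval (1 / (4 * Real.cos (Real.pi / ((m : ℝ) + 1)) ^ 2)) := by
  have hm' : (2 : ℝ) ≤ m := by exact_mod_cast hm
  have hr' : (r : ℝ) + 1 ≤ m := by exact_mod_cast hr
  have hpi := Real.pi_pos
  set t := Real.pi / ((m : ℝ) + 1) with ht
  have htm : ((m : ℝ) + 1) * t = Real.pi := by rw [ht]; field_simp
  have ht0 : 0 < t := by rw [ht]; positivity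
  have hc : 0 < Real.cos t := Real.cos_pos_of_mem_Ioo ⟨by linarith, by nlinarith⟩
  have hs : 0 < Real.sin t := Real.sin_pos_of_pos_of_lt_pi ht0 (by nlinarith)
  have hs2 : 0 < Real.sin (((r : ℝ) + 1) * t) :=
    Real.sin_pos_of_pos_of_lt_pi (by positivity) (by nlinarith)
  rw [← (chebR_aux t hc.ne' r).1] at hs2
  exact pos_of_mul_pos_left (pos_of_mul_pos_left hs2 hs.le) (by positivity)
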